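/- Let F_0, F_1, F_2 ∈ K[T0,T1,Z_0,Z_1,Z_2] and set F = p_0·F_0 + p_1·F_1 + p_2·F_2. Then F lies in the kernel of ψ if and only if det M_A lies in the kernel of ψ, and likewise F lies in the kernel of ψ if and only if det M_B lies in the kernel of ψ; here M_A is the 3×3 matrix with rows (F_0,F_1,F_2), (Z_0,Z_1,Z_2), (A_0,A_1,A_2) and M_B is the 3×3 matrix with rows (F_0,F_1,F_2), (Z_0,Z_1,Z_2), (B_0,B_1,B_2). -/

import Mathlib

open MvPolynomial

noncomputable section

/-- The polynomial ring `K[T0,T1]`. -/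
abbrev PT (K : Type) [Field K] := MvPolynomial (Fin 2) K

/-- The polynomial ring `K[T0,T1,s]`; `Sum.inr () = s`. -/
abbrev PTs (K : Type) [Field K] := MvPolynomial (Fin 2 ⊕ Unit) K

/-- The polynomial ring `K[T0,T1,Z_0,Z_1,Z_2]`. -/
abbrev PTZ (K : Type) [Field K] := MvPolynomial (Fin 2 ⊕ Fin 3) K

/-- The map `ψ : K[T0,T1,Z_0,Z_1,Z_2] → K[T0,T1,s]` with `Z_i ↦ f_i·s`. -/
def psiMap (K : Type) [Field K] (f : Fin 3 → PT K) : PTZ K →ₐ[K] PTs K :=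
  aeval (Sum.elim (fun i => X (Sum.inl i))
    (fun i => rename Sum.inl (f i) * X (Sum.inr ())))

/-- The cross product `p = A × B`. -/
def crossProd (K : Type) [Field K] (A B : Fin 3 → PT K) : Fin 3 → PT K :=
  ![A 1 * B 2 - A 2 * B 1, A 2 * B 0 - A 0 * B 2, A 0 * B 1 - A 1 * B 0]

/-- The `3×3` matrix with rows `(F_0,F_1,F_2)`, `(Z_0,Z_1,Z_2)`, `(C_0,C_1,C_2)`. -/
def matFZC (K : Type) [Field K] (F : Fin 3 → PTZ K) (Cr : Fin 3 → PT K) :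
    Matrix (Fin 3) (Fin 3) (PTZ K) :=
  Matrix.of ![F, fun i => X (Sum.inr i), fun i => rename Sum.inl (Cr i)]

theorem psiMap_rename_inl (K : Type) [Field K] (f : Fin 3 → PT K) (c : PT K) :
    psiMap K f (rename Sum.inl c) = rename Sum.inl c := by
  rw [psiMap, aeval_rename]
  induction c using MvPolynomial.induction_on <;> simp_all

theorem psiMap_X_inr (K : Type) [Field K] (f : Fin 3 → PT K) (i : Fin 3) :
    psiMap K f (X (Sum.inr i)) = rename Sum.inl (f i) * X (Sum.inr ()) := by
  simp [psiMap]

/-- Up to sign, `ψ(det M_A)` is `β·s` times `ψ(F)`. -/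
theorem psiMap_det_matFZC_left (K : Type) [Field K] (α β : PT K) (A B f : Fin 3 → PT K)
    (hf : ∀ i, f i = α * A i + β * B i) (F : Fin 3 → PTZ K) :
    psiMap K f (matFZC K F A).det = -(rename Sum.inl β * X (Sum.inr ())) *
      psiMap K f (∑ i : Fin 3, rename Sum.inl (crossProd K A B i) * F i) := by
  simp [Matrix.det_fin_three, matFZC, crossProd, Fin.sum_univ_three, psiMap_rename_inl,
    psiMap_X_inr, hf]
  ring

/-- `ψ(det M_B)` is `α·s` times `ψ(F)`. -/
theorem psiMap_det_matFZC_right (K : Type) [Field K] (α β : PT K) (A B f : Fin 3 → PT K)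
    (hf : ∀ i, f i = α * A i + β * B i) (F : Fin 3 → PTZ K) :
    psiMap K f (matFZC K F B).det = rename Sum.inl α * X (Sum.inr ()) *
      psiMap K f (∑ i : Fin 3, rename Sum.inl (crossProd K A B i) * F i) := by
  simp [Matrix.det_fin_three, matFZC, crossProd, Fin.sum_univ_three, psiMap_rename_inl,
    psiMap_X_inr, hf]
  ring

theorem rename_inl_mul_X_ne_zero (K : Type) [Field K] {c : PT K} (hc : c ≠ 0) :
    (rename Sum.inl c * X (Sum.inr ()) : PTs K) ≠ 0 :=
  mul_ne_zero ((map_ne_zero_iff _ (rename_injective _ Sum.inl_injective)).2 hc) (X_ne_zero _)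

theorem stmt15 (K : Type) [Field K] (d μ1 μ2 : ℕ) (hμ12 : μ1 ≤ μ2)
    (hd : 2 * (μ1 + μ2) ≤ d)
    (α β : PT K) (hα0 : α ≠ 0) (hβ0 : β ≠ 0)
    (hα : α.IsHomogeneous (d - μ1)) (hβ : β.IsHomogeneous (d - μ2))
    (hcop : ∀ c : PT K, c ∣ α → c ∣ β → IsUnit c)
    (A B : Fin 3 → PT K)
    (hAhom : ∀ i, (A i).IsHomogeneous μ1) (hBhom : ∀ i, (B i).IsHomogeneous μ2)
    (f : Fin 3 → PT K) (hf : ∀ i, f i = α * A i + β * B i)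
    (F : Fin 3 → PTZ K) :
    (psiMap K f (∑ i : Fin 3, rename Sum.inl (crossProd K A B i) * F i) = 0 ↔
      psiMap K f (matFZC K F A).det = 0) ∧
    (psiMap K f (∑ i : Fin 3, rename Sum.inl (crossProd K A B i) * F i) = 0 ↔
      psiMap K f (matFZC K F B).det = 0) := by
  rw [psiMap_det_matFZC_left K α β A B f hf F, psiMap_det_matFZC_right K α β A B f hf F]
  exact ⟨(mul_eq_zero_iff_left (neg_ne_zero.2 (rename_inl_mul_X_ne_zero K hβ0))).symm,
    (mul_eq_zero_iff_left (rename_inl_mul_X_ne_zero K hα0)).symm⟩
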